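/- For every positive integer n, n·t_4(n) = 4·Σ_{j=1}^{n} g(j)·t_4(n − j), where t_4(m) is the number of ordered quadruples (a,b,c,d) of nonnegative integers with a(a+1)/2 + b(b+1)/2 + c(c+1)/2 + d(d+1)/2 = m (with t_4(0) = 1), and g(j) = σ(j) − 4σ(j/2) with σ(j/2) = 0 when j is odd. -/

import Mathlib

/-- Sum of divisors of an integer, with `sigmaZ m = 0` when `m` is not a positive integer. -/
def sigmaZ (m : ℤ) : ℤ := ∑ d ∈ m.toNat.divisors, (d : ℤ)

/-- `sigmaHalf m = sigmaZ (m / 2)` when `m` is even, and `0` when `m` is odd. -/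
def sigmaHalf (m : ℤ) : ℤ := if 2 ∣ m then sigmaZ (m / 2) else 0

/-- `g j = σ(j) - 4σ(j/2)`, with `σ(j/2) = 0` when `j` is odd. -/
def g (j : ℤ) : ℤ := sigmaZ j - 4 * sigmaHalf j

/-- Number of ordered quadruples of nonnegative integers whose triangular numbers sum to `m`. -/
noncomputable def t4 (m : ℕ) : ℕ :=
  Set.ncard {x : ℕ × ℕ × ℕ × ℕ |
    x.1 * (x.1 + 1) / 2 + x.2.1 * (x.2.1 + 1) / 2 + x.2.2.1 * (x.2.2.1 + 1) / 2 +
      x.2.2.2 * (x.2.2.2 + 1) / 2 = m}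

open PowerSeries in
/-- `r k = (1 - X^(2k+2)) / (1 - X^(2k+1))`. -/
noncomputable def rr (k : ℕ) : ℚ⟦X⟧ := (1 - X ^ (2*k+2)) * (1 - X ^ (2*k+1))⁻¹

noncomputable def RR (s n : ℕ) : PowerSeries ℚ := ∏ k ∈ Finset.Ico s n, rr k

open PowerSeries in
theorem one_sub_cc (k : ℕ) : constantCoeff (R := ℚ) (1 - X ^ (k+1)) ≠ 0 := by
  simp

open PowerSeries in
theorem rr_mul (k : ℕ) : (1 - X ^ (2*k+1)) * rr k = (1 - X ^ (2*k+2) : ℚ⟦X⟧) := by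
  unfold rr
  rw [mul_left_comm, PowerSeries.mul_inv_cancel _ (one_sub_cc (2*k)), mul_one]

theorem RR_succ (s n : ℕ) (h : s ≤ n) : RR s (n+1) = RR s n * rr n := by
  unfold RR
  rw [Finset.prod_Ico_succ_top h]

theorem RR_bot (s n : ℕ) (h : s < n) : RR s n = rr s * RR (s+1) n := by
  unfold RR
  rw [Finset.prod_eq_prod_Ico_succ_bot h]

open PowerSeries in
theorem tele (n m : ℕ) (h : m ≤ n) :
    (1 - X ^ (2*n+1)) * ∑ s ∈ Finset.range m,
      (RR s (n+1) * X ^ (s*(2*n+3)) - RR s n * X ^ (s*(2*n+1)))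
    = RR m n * X ^ (m*(2*n+1)) * (1 - X ^ (2*m)) := by
  induction m with
  | zero => simp
  | succ m ih =>
    rw [Finset.sum_range_succ, mul_add, ih (by omega), RR_succ m n (by omega)]
    have h1 := rr_mul n
    have h2 := rr_mul m
    rw [RR_bot m n (by omega)]
    have e1 : (X : ℚ⟦X⟧) ^ (m*(2*n+3)) = X ^ (m*(2*n+1)) * X ^ (2*m) := by
      rw [← pow_add]; ring_nf
    have e2 : (X : ℚ⟦X⟧) ^ ((m+1)*(2*n+1)) = X ^ (m*(2*n+1)) * X ^ (2*n+1) := by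
      rw [← pow_add]; ring_nf
    have e3 : (X : ℚ⟦X⟧) ^ (2*n+2) = X ^ (2*n+1) * X := by rw [← pow_succ]
    have e4 : (X : ℚ⟦X⟧) ^ (2*m+2) = X ^ (2*m) * X * X := by rw [← pow_succ, ← pow_succ]
    have e5 : (X : ℚ⟦X⟧) ^ (2*m+1) = X ^ (2*m) * X := by rw [← pow_succ]
    have e6 : (X : ℚ⟦X⟧) ^ (2*(m+1)) = X ^ (2*m) * X * X := by rw [← e4]; ring_nf
    rw [e1, e2, e6]
    rw [e3] at h1
    rw [e4, e5] at h2
    generalize (X : ℚ⟦X⟧) ^ (m*(2*n+1)) = a at *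
    generalize (X : ℚ⟦X⟧) ^ (2*n+1) = b at *
    generalize (X : ℚ⟦X⟧) ^ (2*m) = c at *
    generalize RR (m+1) n = R at *
    generalize rr n = rn at *
    generalize rr m = rm at *
    linear_combination (rm * R * a * c) * h1 + (R * a * b) * h2

open PowerSeries in
theorem shanks (n : ℕ) :
    ∑ s ∈ Finset.range (2*n), (X : ℚ⟦X⟧) ^ (s*(s+1)/2)
      = ∑ s ∈ Finset.range n, RR s n * X ^ (s*(2*n+1)) := by
  induction n with
  | zero => simp
  | succ n ih =>
    have hc : (1 - X ^ (2*n+1) : ℚ⟦X⟧) ≠ 0 := by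
      intro h
      have := one_sub_cc (2*n)
      rw [h] at this
      simp at this
    apply mul_left_cancel₀ hc
    have ht := tele n n le_rfl
    rw [show 2*(n+1) = 2*n+1+1 by ring, Finset.sum_range_succ, Finset.sum_range_succ, ih,
      Finset.sum_range_succ, RR_succ n n le_rfl]
    rw [Finset.sum_sub_distrib] at ht
    have hR : RR n n = 1 := by simp [RR]
    rw [hR] at ht
    rw [hR]
    have h1 := rr_mul n
    have t1 : 2*n*(2*n+1)/2 = n*(2*n+1) := by
      rw [show 2*n*(2*n+1) = 2*(n*(2*n+1)) by ring]; simp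
    have t2 : (2*n+1)*(2*n+1+1)/2 = n*(2*n+1) + (2*n+1) := by
      rw [show (2*n+1)*(2*n+1+1) = 2*(n*(2*n+1) + (2*n+1)) by ring]; simp
    have e0 : 2*n+1+1+1 = 2*n+3 := by ring
    have e1 : (X : ℚ⟦X⟧) ^ (n*(2*n+3)) = X ^ (n*(2*n+1)) * X ^ (2*n) := by
      rw [← pow_add]; ring_nf
    have e2 : (X : ℚ⟦X⟧) ^ (2*n+2) = X ^ (2*n) * X * X := by rw [← pow_succ, ← pow_succ]
    have e3 : (X : ℚ⟦X⟧) ^ (2*n+1) = X ^ (2*n) * X := by rw [← pow_succ]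
    rw [t1, t2, e0, e1, pow_add X (n*(2*n+1)) (2*n+1)]
    rw [e2] at h1
    rw [e3] at *
    linear_combination (-1 : ℚ⟦X⟧) * ht - X ^ (n*(2*n+1)) * X ^ (2*n) * h1

theorem tri_strictMono : StrictMono (fun k : ℕ => k*(k+1)/2) := by
  apply strictMono_nat_of_lt_succ
  intro k
  show k*(k+1)/2 < (k+1)*(k+1+1)/2
  rw [show (k+1)*(k+1+1) = k*(k+1) + 2*(k+1) by ring]
  omega

noncomputable def GF {α : Type} (f : α → ℕ) : PowerSeries ℚ :=
  PowerSeries.mk fun m => (Nat.card {a // f a = m} : ℚ)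

def fibEquiv {α β : Type} (f : α → ℕ) (h : β → ℕ) (m : ℕ) :
    {p : α × β // f p.1 + h p.2 = m} ≃
      Σ ij : Finset.HasAntidiagonal.antidiagonal m, {a // f a = ij.1.1} × {b // h b = ij.1.2} where
  toFun p := ⟨⟨(f p.1.1, h p.1.2), Finset.HasAntidiagonal.mem_antidiagonal.2 p.2⟩, ⟨p.1.1, rfl⟩, ⟨p.1.2, rfl⟩⟩
  invFun q := ⟨(q.2.1.1, q.2.2.1), by
    rw [q.2.1.2, q.2.2.2]; exact Finset.HasAntidiagonal.mem_antidiagonal.1 q.1.2⟩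
  left_inv p := rfl
  right_inv q := by
    obtain ⟨⟨⟨i, j⟩, hij⟩, ⟨a, ha⟩, ⟨b, hb⟩⟩ := q
    simp only at ha hb
    subst ha hb
    rfl

theorem fib_finite {α β : Type} (f : α → ℕ) (h : β → ℕ)
    (hf : ∀ m, Finite {a // f a = m}) (hh : ∀ m, Finite {a // h a = m}) (m : ℕ) :
    Finite {p : α × β // f p.1 + h p.2 = m} :=
  Finite.of_equiv _ (fibEquiv f h m).symm

theorem GF_mul {α β : Type} (f : α → ℕ) (h : β → ℕ)
    (hf : ∀ m, Finite {a // f a = m}) (hh : ∀ m, Finite {a // h a = m}) :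
    GF (fun p : α × β => f p.1 + h p.2) = GF f * GF h := by
  ext m
  rw [PowerSeries.coeff_mul]
  simp only [GF, PowerSeries.coeff_mk]
  rw [Nat.card_congr (fibEquiv f h m), Nat.card_sigma]
  simp only [Nat.card_prod]
  push_cast
  exact Finset.sum_coe_sort (Finset.HasAntidiagonal.antidiagonal m)
    (fun x : ℕ × ℕ => (Nat.card {a // f a = x.1} : ℚ) * (Nat.card {b // h b = x.2} : ℚ))

def tri (k : ℕ) : ℕ := k*(k+1)/2

theorem tri_fin (m : ℕ) : Finite {a // tri a = m} := by
  have : Subsingleton {a // tri a = m} :=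
    ⟨fun a b => Subtype.ext (tri_strictMono.injective (a.2.trans b.2.symm))⟩
  infer_instance

theorem t4_coeff (m : ℕ) : (t4 m : ℚ) = PowerSeries.coeff m (GF tri ^ 4) := by
  have h2 := fib_finite tri tri tri_fin tri_fin
  have h3 := fib_finite tri _ tri_fin h2
  have e : GF tri ^ 4 = GF (fun p : ℕ × ℕ × ℕ × ℕ =>
      tri p.1 + (tri p.2.1 + (tri p.2.2.1 + tri p.2.2.2))) := by
    rw [GF_mul tri (fun p : ℕ × ℕ × ℕ => tri p.1 + (tri p.2.1 + tri p.2.2)) tri_fin h3,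
      GF_mul tri (fun p : ℕ × ℕ => tri p.1 + tri p.2) tri_fin h2, GF_mul tri tri tri_fin tri_fin]
    ring
  rw [e, GF, PowerSeries.coeff_mk]
  unfold t4
  rw [← Nat.card_coe_set_eq]
  simp only [← add_assoc]
  rfl

open PowerSeries in
theorem coeff_GF_tri (m : ℕ) (n : ℕ) (h : m < n) :
    coeff m (GF tri) = coeff m (∑ s ∈ Finset.range n, (X : ℚ⟦X⟧) ^ (s*(s+1)/2)) := by
  rw [GF, coeff_mk, map_sum]
  simp only [coeff_X_pow]
  rw [Finset.sum_boole]
  congr 1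
  rw [← Nat.card_eq_finsetCard]
  apply Nat.card_congr
  apply Equiv.subtypeEquivRight
  intro a
  rw [Finset.mem_filter, Finset.mem_range]
  constructor
  · intro ha
    have : a ≤ tri a := tri_strictMono.le_apply
    exact ⟨by omega, ha.symm⟩
  · intro ha
    exact ha.2.symm

open PowerSeries in
noncomputable def LL (k : ℕ) : ℚ⟦X⟧ := mk fun j => if k ∣ j ∧ j ≠ 0 then (k : ℚ) else 0

open PowerSeries in
noncomputable def th (f : ℚ⟦X⟧) : ℚ⟦X⟧ := X * d⁄dX ℚ f

open PowerSeries in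
theorem th_mul (f h : ℚ⟦X⟧) : th (f * h) = f * th h + h * th f := by
  simp only [th, Derivation.leibniz, smul_eq_mul]
  ring

open PowerSeries in
theorem coeff_th (f : ℚ⟦X⟧) (n : ℕ) : coeff n (th f) = n * coeff n f := by
  unfold th
  cases n with
  | zero => simp
  | succ n =>
    rw [coeff_succ_X_mul, coeff_derivative]
    push_cast
    ring

open PowerSeries in
theorem LL_mul (k : ℕ) (hk : 0 < k) : (1 - X ^ k) * LL k = - th (1 - X ^ k : ℚ⟦X⟧) := by
  ext j
  rw [map_neg, coeff_th, sub_mul, one_mul, map_sub, coeff_X_pow_mul', LL, coeff_mk, map_sub,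
    coeff_X_pow, coeff_one, coeff_mk]
  by_cases h0 : j = 0
  · subst h0
    simp [hk.ne']
  · by_cases hkj : k ≤ j
    · obtain ⟨i, rfl⟩ := Nat.exists_eq_add_of_le hkj
      by_cases hi : i = 0
      · subst hi
        simp [hk.ne']
      · have : k ∣ k + i ↔ k ∣ i := by simp
        simp [hk.ne', hi, this]
    · have h1 : ¬ k ∣ j := fun hd => hkj (Nat.le_of_dvd (by omega) hd)
      simp [hkj, h0, h1]
      omega

open PowerSeries in
theorem th_rr (k : ℕ) : th (rr k) = (LL (2*k+1) - LL (2*k+2)) * rr k := by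
  have hc : (1 - X ^ (2*k+1) : ℚ⟦X⟧) ≠ 0 := by
    intro h
    have := one_sub_cc (2*k)
    rw [h] at this
    simp at this
  apply mul_left_cancel₀ hc
  have h1 := rr_mul k
  have h2 := congrArg th h1
  rw [th_mul] at h2
  have h3 := LL_mul (2*k+1) (by omega)
  have h4 := LL_mul (2*k+2) (by omega)
  linear_combination h2 - rr k * h3 + h4 + LL (2*k+2) * h1

noncomputable def GN (n : ℕ) : PowerSeries ℚ :=
  ∑ k ∈ Finset.range n, (LL (2*k+1) - LL (2*k+2))

theorem th_RR (n : ℕ) : th (RR 0 n) = GN n * RR 0 n := by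
  induction n with
  | zero => simp [RR, GN, th]
  | succ n ih =>
    rw [RR_succ 0 n (by omega), th_mul, ih, th_rr, GN, GN, Finset.sum_range_succ]
    ring

noncomputable def GG : PowerSeries ℚ := PowerSeries.mk fun j => (g (j : ℤ) : ℚ)

theorem sum_pair (f : ℕ → ℚ) (n : ℕ) :
    ∑ k ∈ Finset.range n, (f (2*k+1) - f (2*k+2)) =
      ∑ k ∈ Finset.Icc 1 (2*n), (f k - if 2 ∣ k then 2 * f k else 0) := by
  induction n with
  | zero => simp
  | succ n ih =>
    rw [Finset.sum_range_succ, ih, show 2*(n+1) = 2*n+1+1 by ring,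
      Finset.sum_Icc_succ_top (by omega), Finset.sum_Icc_succ_top (by omega)]
    rw [if_neg (by omega), if_pos (by omega)]
    ring

theorem g_eq (j : ℕ) : (g (j : ℤ) : ℚ) =
    ∑ d ∈ j.divisors, ((d:ℚ) - if 2 ∣ d then 2 * (d:ℚ) else 0) := by
  unfold g sigmaHalf sigmaZ
  rw [Finset.sum_sub_distrib, ← Finset.sum_filter]
  push_cast
  congr 1
  by_cases h : 2 ∣ j
  · obtain ⟨i, rfl⟩ := h
    rw [if_pos (by simp)]
    have : (((2 * i : ℕ) : ℤ) / 2).toNat = i := by omega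
    rw [this]
    push_cast
    rw [Finset.mul_sum]
    symm
    refine Finset.sum_bij' (fun d _ => d / 2) (fun d _ => 2 * d) ?_ ?_ ?_ ?_ ?_
    · intro d hd
      simp only [Finset.mem_filter, Nat.mem_divisors] at hd
      obtain ⟨⟨h1, h2⟩, c, rfl⟩ := hd
      rw [Nat.mem_divisors]
      simp only [Nat.mul_dvd_mul_iff_left (by norm_num : 0 < 2)] at h1
      refine ⟨by simpa using h1, by omega⟩
    · intro d hd
      simp only [Finset.mem_filter, Nat.mem_divisors] at hd ⊢
      exact ⟨⟨Nat.mul_dvd_mul_left 2 hd.1, by omega⟩, by simp⟩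
    · intro d hd
      simp only [Finset.mem_filter] at hd
      omega
    · intro d hd
      simp
    · intro d hd
      simp only [Finset.mem_filter] at hd
      obtain ⟨_, c, rfl⟩ := hd
      simp
      ring
  · rw [if_neg (by omega), Finset.sum_eq_zero]
    · simp
    · intro d hd
      simp only [Finset.mem_filter, Nat.mem_divisors] at hd
      exact absurd (hd.2.trans hd.1.1) h

open PowerSeries in
theorem coeff_GN (n j : ℕ) (h : j < 2*n) : coeff j (GN n) = coeff j GG := by
  rw [GN, GG, coeff_mk, map_sum, g_eq]
  simp only [map_sub, LL, coeff_mk]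
  have := sum_pair (fun k => if k ∣ j ∧ j ≠ 0 then (k : ℚ) else 0) n
  rw [this]
  symm
  apply Finset.sum_subset_zero_on_sdiff
  · intro d hd
    rw [Nat.mem_divisors] at hd
    have := Nat.le_of_dvd (by omega) hd.1
    have := Nat.pos_of_dvd_of_pos hd.1 (by omega)
    simp; omega
  · intro d hd
    simp only [Finset.mem_sdiff, Nat.mem_divisors] at hd
    simp [hd.2]
  · intro d hd
    rw [Nat.mem_divisors] at hd
    simp [hd]

open PowerSeries in
theorem coeff_RR (n j : ℕ) (h : j < 2*n) : coeff j (GF tri) = coeff j (RR 0 n) := by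
  rw [coeff_GF_tri j (2*n) h, shanks]
  obtain ⟨n, rfl⟩ : ∃ k, n = k+1 := ⟨n-1, by omega⟩
  rw [Finset.sum_range_succ', map_add, map_sum, Finset.sum_eq_zero]
  · simp
  · intro s _
    rw [coeff_mul_X_pow', if_neg]
    nlinarith

open PowerSeries in
theorem th_psi : th (GF tri) = GG * GF tri := by
  ext m
  have h := congrArg (coeff m) (th_RR (m+1))
  rw [coeff_th, ← coeff_RR (m+1) m (by omega)] at h
  rw [coeff_th, h, coeff_mul, coeff_mul]
  apply Finset.sum_congr rfl
  intro p hp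
  rw [Finset.HasAntidiagonal.mem_antidiagonal] at hp
  rw [coeff_GN _ _ (by omega), coeff_RR (m+1) p.2 (by omega)]

open PowerSeries in
theorem th_psi4 : th (GF tri ^ 4) = 4 * (GG * GF tri ^ 4) := by
  have e : GF tri ^ 4 = (GF tri * GF tri) * (GF tri * GF tri) := by ring
  rw [e, th_mul, th_mul, th_psi]
  ring

theorem t4_recurrence (n : ℕ) (hn : 0 < n) :
    (n : ℤ) * (t4 n : ℤ) = 4 * ∑ j ∈ Finset.Icc 1 n, g (j : ℤ) * (t4 (n - j) : ℤ) := by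
  have h := congrArg (PowerSeries.coeff n) th_psi4
  rw [coeff_th, ← t4_coeff, show (4 : PowerSeries ℚ) = PowerSeries.C 4 from (map_ofNat _ 4).symm,
    PowerSeries.coeff_C_mul, PowerSeries.coeff_mul,
    Finset.Nat.sum_antidiagonal_eq_sum_range_succ_mk] at h
  simp only [← t4_coeff, GG, PowerSeries.coeff_mk] at h
  rw [Finset.sum_range_succ'] at h
  have g0 : g ((0 : ℕ) : ℤ) = 0 := by simp [g, sigmaHalf, sigmaZ]
  rw [g0] at h
  have e : ∑ j ∈ Finset.Icc 1 n, g (j : ℤ) * (t4 (n - j) : ℤ) =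
      ∑ j ∈ Finset.range n, g ((j + 1 : ℕ) : ℤ) * (t4 (n - (j+1)) : ℤ) := by
    rw [Finset.range_eq_Ico, Finset.sum_Ico_add' (fun j : ℕ => g (j : ℤ) * (t4 (n - j) : ℤ)) 0 n 1]
    rfl
  rw [e]
  have h' : (n : ℚ) * (t4 n : ℚ) =
      4 * ∑ j ∈ Finset.range n, (g ((j + 1 : ℕ) : ℤ) : ℚ) * (t4 (n - (j+1)) : ℚ) := by
    rw [h]; simp
  exact_mod_cast h'
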